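/- arXiv:math/0610754 — 2 statements merged into one kernel-verified Lean document; each statement's English description precedes it below -/
import Mathlib

section
/- Let G_0 ∈ ℝ, let H : [0,t] → ℝ be continuous, and set G(s) = G_0 + ∫_0^s H(r) dr for s ∈ [0,t]. Let α > γ > 0, c > 0, and ε > 0, and suppose Hol_α(H) ≤ c ε^{−γ}. If t ≥ ε^{(1+γ)/(1+α)}, then sup_{s∈[0,t]} |G(s)| ≤ ε implies sup_{s∈[0,t]} |H(s)| ≤ (2 + c) ε^{(α−γ)/(1+α)}. -/
open MeasureTheory Set

noncomputable section

/-- If `f` stays within `K` of its value at `s` on an interval of length `δ`, then `δ * |f s|` exceeds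
the absolute value of the integral of `f` over this interval by at most `K * δ`. -/
lemma mul_abs_le_abs_integral_add {f : ℝ → ℝ} {a δ s K : ℝ} (hδ : 0 ≤ δ)
    (hf : IntervalIntegrable f volume a (a + δ))
    (hK : ∀ r ∈ Icc a (a + δ), |f s - f r| ≤ K) :
    δ * |f s| ≤ |∫ r in a..(a + δ), f r| + K * δ := by
  have hdiff : |∫ r in a..(a + δ), (f s - f r)| ≤ K * δ := by
    have h := intervalIntegral.norm_integral_le_of_norm_le_const (a := a) (b := a + δ)
      (f := fun r => f s - f r) (C := K) fun r hr => by
        rw [uIoc_of_le (by linarith)] at hr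
        exact hK r (Ioc_subset_Icc_self hr)
    simpa [abs_of_nonneg hδ] using h
  rw [intervalIntegral.integral_sub intervalIntegrable_const hf,
    intervalIntegral.integral_const, smul_eq_mul, add_sub_cancel_left] at hdiff
  calc δ * |f s| = |δ * f s| := by rw [abs_mul, abs_of_nonneg hδ]
    _ ≤ _ := by
      linarith [abs_sub_abs_le_abs_sub (δ * f s) (∫ r in a..(a + δ), f r)]

/-- If `G(s) = G₀ + ∫₀ˢ H(r) dr`, the `α`-Hölder constant of `H` on
`[0,t]` is at most `c ε^{−γ}` (with `α > γ > 0`), and `t ≥ ε^{(1+γ)/(1+α)}`, then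
`sup_{[0,t]} |G| ≤ ε` implies `sup_{[0,t]} |H| ≤ (2+c) ε^{(α−γ)/(1+α)}`. -/
theorem stmt10 (t G0 : ℝ) (H : ℝ → ℝ) (hH : ContinuousOn H (Set.Icc 0 t))
    (α γ c ε : ℝ) (hγ : 0 < γ) (hαγ : γ < α) (hc : 0 < c) (hε : 0 < ε)
    (hhol : ∀ s r : ℝ, 0 ≤ s → s < r → r ≤ t →
      |H s - H r| ≤ c * ε ^ (-γ) * (r - s) ^ α)
    (ht : ε ^ ((1 + γ) / (1 + α)) ≤ t)
    (G : ℝ → ℝ) (hG : ∀ s : ℝ, G s = G0 + ∫ r in (0 : ℝ)..s, H r)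
    (hGsup : ∀ s ∈ Set.Icc (0 : ℝ) t, |G s| ≤ ε) :
    ∀ s ∈ Set.Icc (0 : ℝ) t, |H s| ≤ (2 + c) * ε ^ ((α - γ) / (1 + α)) := by
  set δ := ε ^ ((1 + γ) / (1 + α)) with hδ_def
  have hδ : 0 < δ := Real.rpow_pos_of_pos hε _
  have hα : 0 < α := hγ.trans hαγ
  have hα1 : 1 + α ≠ 0 := by positivity
  intro s hs
  obtain ⟨a, ha0, hat, has, hsa⟩ : ∃ a, 0 ≤ a ∧ a + δ ≤ t ∧ a ≤ s ∧ s ≤ a + δ := by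
    rcases le_total s (t - δ) with h | h
    · exact ⟨s, hs.1, by linarith, le_rfl, by linarith⟩
    · exact ⟨t - δ, by linarith, by linarith, h, by linarith [hs.2]⟩
  have hint : ∀ x y, 0 ≤ x → x ≤ y → y ≤ t → IntervalIntegrable H volume x y :=
    fun x y hx hxy hy => (hH.mono (Icc_subset_Icc hx hy)).intervalIntegrable_of_Icc hxy
  have hcε : 0 ≤ c * ε ^ (-γ) := by positivity
  have hK : ∀ r ∈ Icc a (a + δ), |H s - H r| ≤ c * ε ^ (-γ) * δ ^ α := by
    intro r hr
    rcases lt_trichotomy s r with h | h | h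
    · refine (hhol s r hs.1 h (by linarith [hr.2])).trans ?_
      gcongr
      linarith [hr.2]
    · subst h
      simpa using by positivity
    · rw [abs_sub_comm]
      refine (hhol r s (by linarith [hr.1]) h hs.2).trans ?_
      gcongr
      linarith [hr.1]
  have hI : |∫ r in a..(a + δ), H r| ≤ 2 * ε := by
    have hsub : ∫ r in a..(a + δ), H r = G (a + δ) - G a := by
      rw [hG, hG, ← intervalIntegral.integral_add_adjacent_intervals
        (hint 0 a le_rfl ha0 (by linarith)) (hint a (a + δ) ha0 (by linarith) hat)]
      ring
    rw [hsub]
    linarith [abs_sub (G (a + δ)) (G a), hGsup a ⟨ha0, by linarith⟩,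
      hGsup (a + δ) ⟨by linarith, hat⟩]
  have hmain := mul_abs_le_abs_integral_add hδ.le (hint a (a + δ) ha0 (by linarith) hat) hK
  have hε_eq : ε = δ * ε ^ ((α - γ) / (1 + α)) := by
    rw [hδ_def, ← Real.rpow_add hε, ← add_div, show 1 + γ + (α - γ) = 1 + α by ring,
      div_self hα1, Real.rpow_one]
  have hpow : ε ^ (-γ) * δ ^ α = ε ^ ((α - γ) / (1 + α)) := by
    rw [hδ_def, ← Real.rpow_mul hε.le, ← Real.rpow_add hε]
    congr 1
    field_simp
    ring
  refine le_of_mul_le_mul_left ?_ hδ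
  calc δ * |H s| ≤ 2 * ε + c * (ε ^ (-γ) * δ ^ α) * δ := by linarith
    _ = 2 * (δ * ε ^ ((α - γ) / (1 + α))) + c * ε ^ ((α - γ) / (1 + α)) * δ := by
      rw [hpow, ← hε_eq]
    _ = δ * ((2 + c) * ε ^ ((α - γ) / (1 + α))) := by ring
end
end

section
/- Let t > 0, l > 0, ρ > γ > 0, c > 0, and let f : [0,t] → ℝ be continuous. Suppose 0 < ε ≤ 1 and t ≥ ε^{(1+γl)/(1+lρ)}. If ∫_0^t |f(s)|^l ds < ε and Hol_ρ(f) < c ε^{−γ}, then sup_{s∈[0,t]} |f(s)| < (1 + c) ε^{(ρ−γ)/(1+lρ)}. -/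
open MeasureTheory Set

noncomputable section

/-- A continuous function whose `l`-th absolute moment over `[0,t]` is less than `A ^ l * δ` takes
a value of absolute value less than `A` on every subinterval of length `δ`. -/
theorem exists_abs_lt_of_integral_rpow_lt {t l A p δ : ℝ} {f : ℝ → ℝ} (hl : 0 < l) (hA : 0 ≤ A)
    (hp : 0 ≤ p) (hδ : 0 ≤ δ) (hpt : p + δ ≤ t) (hf : ContinuousOn f (Icc 0 t))
    (hint : ∫ s in (0 : ℝ)..t, |f s| ^ l < A ^ l * δ) :
    ∃ r ∈ Icc p (p + δ), |f r| < A := by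
  by_contra! h
  have hg : ContinuousOn (fun s => |f s| ^ l) (Icc 0 t) :=
    hf.abs.rpow_const fun _ _ => Or.inr hl.le
  have hgt : IntervalIntegrable (fun s => |f s| ^ l) volume 0 t :=
    hg.intervalIntegrable_of_Icc (by linarith)
  have hgp : IntervalIntegrable (fun s => |f s| ^ l) volume p (p + δ) :=
    (hg.mono (Icc_subset_Icc hp hpt)).intervalIntegrable_of_Icc (by linarith)
  have h1 : A ^ l * δ ≤ ∫ s in p..(p + δ), |f s| ^ l := by
    have := intervalIntegral.integral_mono_on (by linarith : p ≤ p + δ)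
      (intervalIntegrable_const (c := A ^ l)) hgp
      fun r hr => Real.rpow_le_rpow hA (h r hr) hl.le
    rw [intervalIntegral.integral_const, smul_eq_mul] at this
    linarith
  have h2 : ∫ s in p..(p + δ), |f s| ^ l ≤ ∫ s in (0 : ℝ)..t, |f s| ^ l :=
    intervalIntegral.integral_mono_interval hp (by linarith) hpt
      (Filter.Eventually.of_forall fun _ => by positivity) hgt
  linarith

/-- A one-sided increment bound on ordered pairs with constant `M ≤ K` gives the symmetric Hölder
bound with constant `K`. -/
theorem abs_sub_le_of_holder_increment {t ρ M K δ : ℝ} {f : ℝ → ℝ} (hρ : 0 < ρ) (hMK : M ≤ K)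
    (hK : 0 ≤ K) (hδ : 0 ≤ δ)
    (hM : ∀ s r : ℝ, 0 ≤ s → s < r → r ≤ t → |f s - f r| ≤ M * (r - s) ^ ρ)
    {x y : ℝ} (hx : x ∈ Icc 0 t) (hy : y ∈ Icc 0 t) (hxy : |x - y| ≤ δ) :
    |f x - f y| ≤ K * δ ^ ρ := by
  have key : ∀ u v : ℝ, 0 ≤ u → u < v → v ≤ t → v - u ≤ δ → |f u - f v| ≤ K * δ ^ ρ := by
    intro u v hu huv hv huvδ
    have h0 : 0 ≤ v - u := by linarith
    calc |f u - f v| ≤ M * (v - u) ^ ρ := hM u v hu huv hv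
      _ ≤ K * δ ^ ρ := by gcongr
  rw [abs_le] at hxy
  rcases lt_trichotomy x y with h | rfl | h
  · exact key x y hx.1 h hy.2 (by linarith)
  · rw [sub_self, abs_zero]
    positivity
  · rw [abs_sub_comm]
    exact key y x hy.1 h hx.2 (by linarith)

/-- If `f` is continuous on `[0,t]`, `∫₀ᵗ |f|ˡ < ε`, and the `ρ`-Hölder
constant of `f` on `[0,t]` is `< c ε^{−γ}` (with `ρ > γ > 0`, `0 < ε ≤ 1`,
`t ≥ ε^{(1+γl)/(1+lρ)}`), then `sup_{[0,t]} |f| < (1+c) ε^{(ρ−γ)/(1+lρ)}`. -/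
theorem stmt11 (t l ρ γ c ε : ℝ) (ht : 0 < t) (hl : 0 < l) (hγ : 0 < γ)
    (hγρ : γ < ρ) (hc : 0 < c) (hε0 : 0 < ε) (hε1 : ε ≤ 1)
    (htε : ε ^ ((1 + γ * l) / (1 + l * ρ)) ≤ t)
    (f : ℝ → ℝ) (hf : ContinuousOn f (Set.Icc 0 t))
    (hint : ∫ s in (0 : ℝ)..t, |f s| ^ l < ε)
    (hhol : ∃ M : ℝ, M < c * ε ^ (-γ) ∧
      ∀ s r : ℝ, 0 ≤ s → s < r → r ≤ t → |f s - f r| ≤ M * (r - s) ^ ρ) :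
    ∀ s ∈ Set.Icc (0 : ℝ) t, |f s| < (1 + c) * ε ^ ((ρ - γ) / (1 + l * ρ)) := by
  obtain ⟨M, hMc, hM⟩ := hhol
  intro s hs
  have hD : 1 + l * ρ ≠ 0 := by nlinarith [mul_pos hl (hγ.trans hγρ)]
  set δ := ε ^ ((1 + γ * l) / (1 + l * ρ)) with hδ
  set A := ε ^ ((ρ - γ) / (1 + l * ρ)) with hA
  have hδ0 : 0 < δ := Real.rpow_pos_of_pos hε0 _
  have hA0 : 0 < A := Real.rpow_pos_of_pos hε0 _
  have hAδ : A ^ l * δ = ε := by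
    rw [hA, hδ, ← Real.rpow_mul hε0.le, ← Real.rpow_add hε0]
    convert Real.rpow_one ε using 2
    rw [div_mul_eq_mul_div, ← add_div, div_eq_one_iff_eq hD]
    ring
  have hδA : c * ε ^ (-γ) * δ ^ ρ = c * A := by
    rw [hA, hδ, ← Real.rpow_mul hε0.le, mul_assoc, ← Real.rpow_add hε0]
    congr 2
    field_simp
    ring
  set p := min s (t - δ) with hp
  have hp0 : 0 ≤ p := le_min hs.1 (by linarith)
  have hps : p ≤ s := min_le_left _ _
  have hpt : p + δ ≤ t := by linarith [min_le_right s (t - δ)]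
  have hsp : s ≤ p + δ := by
    rw [hp, ← min_add_add_right]
    exact le_min (by linarith) (by linarith [hs.2])
  obtain ⟨r, hr, hfr⟩ := exists_abs_lt_of_integral_rpow_lt hl hA0.le hp0 hδ0.le hpt hf
    (hint.trans_eq hAδ.symm)
  have hsr : |f s - f r| ≤ c * ε ^ (-γ) * δ ^ ρ :=
    abs_sub_le_of_holder_increment (hγ.trans hγρ) hMc.le (by positivity) hδ0.le hM hs
      ⟨hp0.trans hr.1, hr.2.trans hpt⟩
      (abs_le.2 ⟨by linarith [hr.2], by linarith [hr.1]⟩)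
  linarith [abs_sub_abs_le_abs_sub (f s) (f r)]
end
end
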